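/- arXiv:2208.13231 — 3 statements merged into one kernel-verified Lean document; each statement's English description precedes it below -/
import Mathlib

section
/- Let $d \ge 2$ and let $c_0, c_2, m > 0$ with $c_2 > 1$. Let $A \in \mathbb{R}^{d \times d}$ be symmetric and satisfy $c_0^{-1}|\eta|^2 \le \eta^{\top} A \eta \le c_0 |\eta|^2$ for all $\eta \in \mathbb{R}^d$, let $s \in \mathbb{R}$ with $c_2^{-1} < s < c_2$, and let $p \in \mathbb{R}^{d-1}$ with $|p| \le m$. Set $\tilde v := \frac{1}{s}(1, -p)$, write $A = \begin{bmatrix} a_{11} & \vec{a}'^{\top} \\ \vec{a}' & A_{d-1} \end{bmatrix}$, and define $\widetilde{A} := -\frac{1}{s}\begin{bmatrix} \tilde v^{\top} A \tilde v & \frac{1}{s}(\vec{a}' - A_{d-1} p)^{\top} \\ \frac{1}{s}(\vec{a}' - A_{d-1} p) & A_{d-1} \end{bmatrix}$. Then there exists a constant $c_4 > 0$, depending only on $c_0$, $c_2$ and $m$, such that $c_4^{-1}|\xi|^2 \le -\xi^{\top} \widetilde{A}\, \xi \le c_4 |\xi|^2$ for all $\xi \in \mathbb{R}^d$. In particular $-\widetilde{A}$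 is positive definite. -/
open Matrix

/-- The principal coefficient matrix `Ã` of the linearization of the
Hodograph-transformed equation, built from the coefficient matrix `A`,
the value `s` of `∂₁z` and the value `p` of `∇_{y'}z`. -/
noncomputable def tildeMatrix (m : ℕ) (A : Matrix (Fin (m + 1)) (Fin (m + 1)) ℝ)
    (s : ℝ) (p : Fin m → ℝ) : Matrix (Fin (m + 1)) (Fin (m + 1)) ℝ :=
  let vt : Fin (m + 1) → ℝ := s⁻¹ • (Fin.cons 1 (-p) : Fin (m + 1) → ℝ)
  let q : Fin m → ℝ :=
    (fun j => A 0 j.succ) - (Matrix.of fun i j : Fin m => A i.succ j.succ).mulVec p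
  (-s⁻¹) • Matrix.of (Fin.cons
    (Fin.cons (vt ⬝ᵥ A.mulVec vt) (s⁻¹ • q))
    (fun i => Fin.cons (s⁻¹ * q i) (fun j => A i.succ j.succ)))


lemma aux_form (m : ℕ) (M : Matrix (Fin (m + 1)) (Fin (m + 1)) ℝ) (hM : ∀ i : Fin m, M i.succ 0 = M 0 i.succ)
    (η : Fin (m + 1) → ℝ) :
    η ⬝ᵥ M.mulVec η = η 0 ^ 2 * M 0 0 + 2 * η 0 * ((fun j : Fin m => M 0 j.succ) ⬝ᵥ (fun j => η j.succ))
      + (fun j : Fin m => η j.succ) ⬝ᵥ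
        (Matrix.of fun i j : Fin m => M i.succ j.succ).mulVec (fun j => η j.succ) := by
  simp only [dotProduct, mulVec, Fin.sum_univ_succ, hM, Matrix.of_apply, mul_add, Finset.sum_add_distrib]
  have : ∑ i : Fin m, η i.succ * (M 0 i.succ * η 0) = η 0 * ∑ i : Fin m, M 0 i.succ * η i.succ := by
    rw [Finset.mul_sum]; exact Finset.sum_congr rfl fun i _ => by ring
  rw [this]; ring

lemma aux_dot (m : ℕ) (η : Fin (m + 1) → ℝ) :
    η ⬝ᵥ η = η 0 ^ 2 + (fun j : Fin m => η j.succ) ⬝ᵥ (fun j => η j.succ) := by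
  simp only [dotProduct, Fin.sum_univ_succ]; ring

lemma tilde_form (m : ℕ) (A : Matrix (Fin (m + 1)) (Fin (m + 1)) ℝ) (hA : A.IsSymm)
    (s : ℝ) (p : Fin m → ℝ) (ξ : Fin (m + 1) → ℝ) (η : Fin (m + 1) → ℝ)
    (hη : η = Fin.cons (s⁻¹ * ξ 0) ((fun j : Fin m => ξ j.succ) - (s⁻¹ * ξ 0) • p)) :
    -(ξ ⬝ᵥ (tildeMatrix m A s p).mulVec ξ) = s⁻¹ * (η ⬝ᵥ A.mulVec η) := by
  have hs : ∀ i : Fin m, A i.succ 0 = A 0 i.succ := fun i => hA.apply 0 i.succ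
  have hB : (Matrix.of fun i j : Fin m => A i.succ j.succ)ᵀ
      = Matrix.of fun i j : Fin m => A i.succ j.succ := by
    ext i j; exact hA.apply i.succ j.succ
  rw [aux_form m _ (fun i => by simp [tildeMatrix]) ξ, aux_form m A hs η]
  subst hη
  simp only [tildeMatrix]
  rw [aux_form m A hs (s⁻¹ • _)]
  simp only [Matrix.smul_apply, Matrix.of_apply, Fin.cons_zero, Fin.cons_succ, smul_eq_mul, Pi.smul_apply]
  generalize hBd : (Matrix.of fun i j : Fin m => A i.succ j.succ) = B at *
  have e1 : (Matrix.of fun i j : Fin m => -s⁻¹ * A i.succ j.succ) = (-s⁻¹) • B := by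
    rw [← hBd]; rfl
  have e2 : (fun j : Fin m => s⁻¹ * (-p) j) = (-s⁻¹) • p := by
    ext j; simp
  have e3 : (fun j : Fin m => -s⁻¹ * (s⁻¹ * ((fun j : Fin m => A 0 j.succ) - B *ᵥ p) j))
      = (-s⁻¹ * s⁻¹) • ((fun j : Fin m => A 0 j.succ) - B *ᵥ p) := by
    ext j; simp; ring
  have e4 : (fun j : Fin m => ((fun j : Fin m => ξ j.succ) - (s⁻¹ * ξ 0) • p) j)
      = ((fun j : Fin m => ξ j.succ) - (s⁻¹ * ξ 0) • p) := rfl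
  rw [e1, e2, e3, e4]
  generalize (fun j : Fin m => ξ j.succ) = x
  generalize (fun j : Fin m => A 0 j.succ) = b
  have e5 : p ⬝ᵥ B *ᵥ x = (B *ᵥ p) ⬝ᵥ x := by
    rw [dotProduct_mulVec, ← mulVec_transpose, hB]
  have e6 : x ⬝ᵥ B *ᵥ p = (B *ᵥ p) ⬝ᵥ x := dotProduct_comm _ _
  simp only [smul_mulVec, mulVec_smul, mulVec_sub, sub_dotProduct, dotProduct_sub, smul_dotProduct,
    dotProduct_smul, smul_eq_mul, e5, e6]
  ring

lemma aux_bound {m : ℕ} (x p : Fin m → ℝ) (r : ℝ) :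
    (x - r • p) ⬝ᵥ (x - r • p) ≤ 2 * (x ⬝ᵥ x) + 2 * (r ^ 2 * (p ⬝ᵥ p)) := by
  have h : 0 ≤ (x + r • p) ⬝ᵥ (x + r • p) := by
    simpa using dotProduct_star_self_nonneg (x + r • p)
  have e := dotProduct_comm x p
  simp only [sub_dotProduct, dotProduct_sub, add_dotProduct, dotProduct_add, smul_dotProduct,
    dotProduct_smul, smul_eq_mul, e] at h ⊢
  nlinarith

lemma dot_nn {m : ℕ} (x : Fin m → ℝ) : 0 ≤ x ⬝ᵥ x := by
  simpa using dotProduct_star_self_nonneg x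

/-- Uniform ellipticity of the linearized Hodograph-transformed
operator: if `A` is symmetric and uniformly elliptic with constant `c₀`,
`c₂⁻¹ < s < c₂` and `|p| ≤ m₀`, then there is a constant `c₄ > 0`, depending only on
`c₀`, `c₂`, `m₀` (and the dimension), such that
`c₄⁻¹|ξ|² ≤ -ξᵀ Ã ξ ≤ c₄|ξ|²` for all `ξ`; in particular `-Ã` is positive definite. -/
theorem tilde_matrix_elliptic (m : ℕ) (hm : 1 ≤ m) (c₀ c₂ m₀ : ℝ)
    (hc₀ : 0 < c₀) (hc₂ : 1 < c₂) (hm₀ : 0 < m₀) :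
    ∃ c₄ : ℝ, 0 < c₄ ∧
      ∀ (A : Matrix (Fin (m + 1)) (Fin (m + 1)) ℝ), A.IsSymm →
        (∀ η : Fin (m + 1) → ℝ,
          c₀⁻¹ * (η ⬝ᵥ η) ≤ η ⬝ᵥ A.mulVec η ∧ η ⬝ᵥ A.mulVec η ≤ c₀ * (η ⬝ᵥ η)) →
        ∀ s : ℝ, c₂⁻¹ < s → s < c₂ →
        ∀ p : Fin m → ℝ, p ⬝ᵥ p ≤ m₀ ^ 2 →
          (∀ ξ : Fin (m + 1) → ℝ,
            c₄⁻¹ * (ξ ⬝ᵥ ξ) ≤ -(ξ ⬝ᵥ (tildeMatrix m A s p).mulVec ξ) ∧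
            -(ξ ⬝ᵥ (tildeMatrix m A s p).mulVec ξ) ≤ c₄ * (ξ ⬝ᵥ ξ)) ∧
          (-(tildeMatrix m A s p)).PosDef := by
  have hc2 : 0 < c₂ := by linarith
  set K : ℝ := c₂ ^ 2 * (1 + 2 * m₀ ^ 2) + 2 with hK
  have hKp : 0 < K := by positivity
  have hc4 : 0 < c₀ * c₂ * K := by positivity
  refine ⟨c₀ * c₂ * K, hc4, ?_⟩
  intro A hA hell s hs1 hs2 p hp
  have hs : 0 < s := lt_trans (by positivity) hs1
  have hsi : s⁻¹ < c₂ := inv_lt_of_inv_lt₀ hc2 hs1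
  have hsi2 : c₂⁻¹ < s⁻¹ := (inv_lt_inv₀ hc2 hs).2 hs2
  have main : ∀ ξ : Fin (m + 1) → ℝ,
      (c₀ * c₂ * K)⁻¹ * (ξ ⬝ᵥ ξ) ≤ -(ξ ⬝ᵥ (tildeMatrix m A s p).mulVec ξ) ∧
      -(ξ ⬝ᵥ (tildeMatrix m A s p).mulVec ξ) ≤ c₀ * c₂ * K * (ξ ⬝ᵥ ξ) := by
    intro ξ
    obtain ⟨η, hη⟩ : ∃ η : Fin (m + 1) → ℝ,
      η = Fin.cons (s⁻¹ * ξ 0) ((fun j : Fin m => ξ j.succ) - (s⁻¹ * ξ 0) • p) := ⟨_, rfl⟩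
    rw [tilde_form m A hA s p ξ η hη]
    have hdξ := aux_dot m ξ
    have hdη : η ⬝ᵥ η = (s⁻¹ * ξ 0) ^ 2 + ((fun j : Fin m => ξ j.succ) - (s⁻¹ * ξ 0) • p) ⬝ᵥ
        ((fun j : Fin m => ξ j.succ) - (s⁻¹ * ξ 0) • p) := by
      rw [aux_dot m η, hη]; rfl
    obtain ⟨h1, h2⟩ := hell η
    have hm2 : 0 ≤ m₀ ^ 2 := by positivity
    have hc21 : 1 ≤ c₂ ^ 2 := by nlinarith
    have up : η ⬝ᵥ η ≤ K * (ξ ⬝ᵥ ξ) := by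
      have hb := aux_bound (fun j : Fin m => ξ j.succ) p (s⁻¹ * ξ 0)
      have hx := dot_nn (fun j : Fin m => ξ j.succ)
      rw [hdη, hdξ]
      generalize (fun j : Fin m => ξ j.succ) = x at *
      have h3 : (s⁻¹ * ξ 0) ^ 2 ≤ c₂ ^ 2 * ξ 0 ^ 2 := by
        rw [mul_pow]; gcongr
      have h4 : (s⁻¹ * ξ 0) ^ 2 * (p ⬝ᵥ p) ≤ (c₂ ^ 2 * ξ 0 ^ 2) * m₀ ^ 2 := by
        have := dot_nn p
        gcongr
      have h5 : 0 ≤ (c₂ ^ 2 * (1 + 2 * m₀ ^ 2)) * (x ⬝ᵥ x) := by positivity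
      have h6 := sq_nonneg (ξ 0)
      rw [hK]
      linarith
    have lo : ξ ⬝ᵥ ξ ≤ K * (η ⬝ᵥ η) := by
      obtain ⟨r, hr⟩ : ∃ r, r = s⁻¹ * ξ 0 := ⟨_, rfl⟩
      have h0 : ξ 0 = s * r := by rw [hr]; field_simp
      rw [hdη, hdξ, ← hr]
      generalize (fun j : Fin m => ξ j.succ) = x at *
      have hb := aux_bound (x - r • p) p (-r)
      have e : x - r • p - -r • p = x := by simp
      rw [e] at hb
      have hx := dot_nn (x - r • p)
      generalize (x - r • p) ⬝ᵥ (x - r • p) = y at *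
      have h3 : ξ 0 ^ 2 ≤ c₂ ^ 2 * r ^ 2 := by
        rw [h0, mul_pow]; gcongr
      have h4 : (-r) ^ 2 * (p ⬝ᵥ p) ≤ r ^ 2 * m₀ ^ 2 := by
        rw [neg_sq]; gcongr
      have h5 : 0 ≤ (c₂ ^ 2 * (1 + 2 * m₀ ^ 2)) * y := by positivity
      have h6 := sq_nonneg r
      have h7 : 0 ≤ (c₂ ^ 2 - 1) * (r ^ 2 * m₀ ^ 2) :=
        mul_nonneg (by linarith) (by positivity)
      rw [hK]
      linarith
    have hηn := dot_nn η
    constructor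
    · calc (c₀ * c₂ * K)⁻¹ * (ξ ⬝ᵥ ξ) ≤ (c₀ * c₂ * K)⁻¹ * (K * (η ⬝ᵥ η)) := by gcongr
        _ = c₂⁻¹ * (c₀⁻¹ * (η ⬝ᵥ η)) := by field_simp
        _ ≤ s⁻¹ * (η ⬝ᵥ A.mulVec η) := by gcongr
    · calc s⁻¹ * (η ⬝ᵥ A.mulVec η) ≤ c₂ * (c₀ * (K * (ξ ⬝ᵥ ξ))) := by
            have : 0 ≤ η ⬝ᵥ A.mulVec η := le_trans (by positivity) h1
            have h8 : η ⬝ᵥ A.mulVec η ≤ c₀ * (K * (ξ ⬝ᵥ ξ)) := h2.trans (by gcongr)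
            gcongr
        _ = c₀ * c₂ * K * (ξ ⬝ᵥ ξ) := by ring
  refine ⟨main, ?_⟩
  refine Matrix.PosDef.of_dotProduct_mulVec_pos ?_ ?_
  · ext i j
    refine Fin.cases ?_ (fun i => ?_) i <;> refine Fin.cases ?_ (fun j => ?_) j <;>
      simp [tildeMatrix, hA.apply]
  · intro x hx
    have h := (main x).1
    have hpos : 0 < x ⬝ᵥ x := by
      have := dotProduct_star_self_pos_iff.2 hx
      simpa using this
    simp only [star_trivial, neg_mulVec, dotProduct_neg]
    exact lt_of_lt_of_le (by positivity) h
end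

section
/- Let $a > 0$, let $p, q$ be nonnegative integers, set $k^2 := (p^2+q^2)\pi^2$ and $w(x_1,x_2) := \cos(p\pi x_1)\cos(q\pi x_2)$. Define the coefficients $A(x) := a I$ and $n(x) := a$ for $x$ in the unit square $Q = (0,1)\times(0,1)$, and $A(x) := I$, $n(x) := 1$ for $x \notin Q$. Then $w$ is a global weak solution of $\nabla \cdot (A \nabla u) + k^2 n u = 0$ in $\mathbb{R}^2$: for every smooth compactly supported test function $\varphi : \mathbb{R}^2 \to \mathbb{R}$, $\int_{\mathbb{R}^2} \big(A(x)\nabla w(x)\big) \cdot \nabla \varphi(x)\, dx = k^2 \int_{\mathbb{R}^2} n(x)\, w(x)\, \varphi(x)\, dx$. -/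
open Real Matrix MeasureTheory

/-- The derivative of a compactly supported `C¹` function is integrable. -/
lemma aux_int (g : ℝ × ℝ → ℝ) (hg : ContDiff ℝ 1 g) (hc : HasCompactSupport g) (v : ℝ × ℝ) :
    Integrable (fun x => fderiv ℝ g x v) := by
  have h1 : Continuous (fun x => fderiv ℝ g x v) :=
    (hg.continuous_fderiv one_ne_zero).clm_apply continuous_const
  exact h1.integrable_of_hasCompactSupport (hc.fderiv_apply ℝ v)

lemma aux_deriv1 (g : ℝ × ℝ → ℝ) (hg : ContDiff ℝ 1 g) (x y : ℝ) :
    HasDerivAt (fun t => g (t, y)) (fderiv ℝ g (x, y) (1, 0)) x := by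
  have h := (hg.differentiable one_ne_zero (x, y)).hasFDerivAt
  exact h.comp_hasDerivAt x ((hasDerivAt_id x).prodMk (hasDerivAt_const x y))

lemma aux_slice (g : ℝ × ℝ → ℝ) (hc : HasCompactSupport g) (y : ℝ) :
    HasCompactSupport (fun t => g (t, y)) :=
  hc.comp_isClosedEmbedding (Topology.IsClosedEmbedding.of_continuous_injective_isClosedMap
    (by fun_prop) (fun a b h => by simpa using h) (isClosedMap_prodMk_right y))

lemma aux_full (g : ℝ × ℝ → ℝ) (hg : ContDiff ℝ 1 g) (hc : HasCompactSupport g) :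
    ∫ x, fderiv ℝ g x (1, 0) = 0 := by
  have hi := aux_int g hg hc (1, 0)
  rw [Measure.volume_eq_prod] at hi ⊢
  rw [integral_prod_symm _ hi]
  have : ∀ y : ℝ, ∫ x : ℝ, fderiv ℝ g (x, y) (1, 0) = 0 := by
    intro y
    have hcy := aux_slice g hc y
    have hcont : Continuous (fun x : ℝ => g (x, y)) := by
      have := hg.continuous
      fun_prop
    have hcd : Continuous (fun x : ℝ => fderiv ℝ g (x, y) (1, 0)) :=
      ((hg.continuous_fderiv one_ne_zero).clm_apply continuous_const).comp
        (g := fun z => fderiv ℝ g z (1, 0)) (by fun_prop : Continuous fun x : ℝ => (x, y))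
    apply integral_eq_zero_of_hasDerivAt_of_integrable (fun x => aux_deriv1 g hg x y)
    · exact hcd.integrable_of_hasCompactSupport
        (aux_slice _ (hc.fderiv_apply ℝ (1, 0)) y)
    · exact hcont.integrable_of_hasCompactSupport hcy
  simp [this]

lemma aux_square (g : ℝ × ℝ → ℝ) (hg : ContDiff ℝ 1 g) (hc : HasCompactSupport g)
    (h0 : ∀ y, g (0, y) = 0) (h1 : ∀ y, g (1, y) = 0) :
    ∫ x in Set.Ioo (0 : ℝ) 1 ×ˢ Set.Ioo (0 : ℝ) 1, fderiv ℝ g x (1, 0) = 0 := by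
  have hi := (aux_int g hg hc (1, 0)).integrableOn (s := Set.Ioo (0 : ℝ) 1 ×ˢ Set.Ioo (0 : ℝ) 1)
  rw [Measure.volume_eq_prod] at hi ⊢
  rw [IntegrableOn, ← Measure.prod_restrict] at hi
  rw [← Measure.prod_restrict, integral_prod_symm _ hi]
  have : ∀ y : ℝ, ∫ x in Set.Ioo (0 : ℝ) 1, fderiv ℝ g (x, y) (1, 0) = 0 := by
    intro y
    have hcd : Continuous (fun x : ℝ => fderiv ℝ g (x, y) (1, 0)) :=
      ((hg.continuous_fderiv one_ne_zero).clm_apply continuous_const).comp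
        (g := fun z => fderiv ℝ g z (1, 0)) (by fun_prop : Continuous fun x : ℝ => (x, y))
    rw [← integral_Ioc_eq_integral_Ioo, ← intervalIntegral.integral_of_le zero_le_one,
      intervalIntegral.integral_eq_sub_of_hasDerivAt (fun x _ => aux_deriv1 g hg x y)
        (hcd.intervalIntegrable _ _), h0, h1, sub_zero]
  simp [this]

lemma aux_swap (g : ℝ × ℝ → ℝ) (hg : ContDiff ℝ 1 g) (x : ℝ × ℝ) :
    fderiv ℝ (g ∘ Prod.swap) x (1, 0) = fderiv ℝ g x.swap (0, 1) := by
  have h := (hg.differentiable one_ne_zero x.swap).hasFDerivAt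
  have h2 := (ContinuousLinearEquiv.prodComm ℝ ℝ ℝ).hasFDerivAt (x := x)
  have h3 : HasFDerivAt (g ∘ Prod.swap) _ x := HasFDerivAt.comp x h h2
  rw [h3.fderiv]
  simp

lemma aux_swap_supp (g : ℝ × ℝ → ℝ) (hc : HasCompactSupport g) :
    HasCompactSupport (g ∘ Prod.swap) :=
  hc.comp_homeomorph (Homeomorph.prodComm ℝ ℝ)

lemma aux_full2 (g : ℝ × ℝ → ℝ) (hg : ContDiff ℝ 1 g) (hc : HasCompactSupport g) :
    ∫ x, fderiv ℝ g x (0, 1) = 0 := by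
  have h := aux_full (g ∘ Prod.swap) (hg.comp (contDiff_snd.prodMk contDiff_fst)) (aux_swap_supp g hc)
  simp_rw [aux_swap g hg] at h
  rw [Measure.volume_eq_prod] at h ⊢
  rwa [integral_prod_swap (fun x => fderiv ℝ g x (0, 1))] at h

lemma aux_square2 (g : ℝ × ℝ → ℝ) (hg : ContDiff ℝ 1 g) (hc : HasCompactSupport g)
    (h0 : ∀ y, g (y, 0) = 0) (h1 : ∀ y, g (y, 1) = 0) :
    ∫ x in Set.Ioo (0 : ℝ) 1 ×ˢ Set.Ioo (0 : ℝ) 1, fderiv ℝ g x (0, 1) = 0 := by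
  have h := aux_square (g ∘ Prod.swap) (hg.comp (contDiff_snd.prodMk contDiff_fst)) (aux_swap_supp g hc) h0 h1
  simp_rw [aux_swap g hg] at h
  rw [Measure.volume_eq_prod] at h ⊢
  rw [← Measure.prod_restrict] at h ⊢
  rwa [integral_prod_swap (fun x => fderiv ℝ g x (0, 1))] at h

lemma aux_w1 (c d : ℝ) (x : ℝ × ℝ) :
    fderiv ℝ (fun x : ℝ × ℝ => Real.cos (c * x.1) * Real.cos (d * x.2)) x (1, 0)
      = -c * Real.sin (c * x.1) * Real.cos (d * x.2) := by
  have h := aux_deriv1 (fun x : ℝ × ℝ => Real.cos (c * x.1) * Real.cos (d * x.2))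
    (by fun_prop) x.1 x.2
  have h2 := (((hasDerivAt_id x.1).const_mul c).cos).mul_const (Real.cos (d * x.2))
  have := h.unique h2
  simp only [id] at this
  rw [this]; ring

lemma aux_g1 (c d : ℝ) (φ : ℝ × ℝ → ℝ) (hφ : ContDiff ℝ 1 φ) (x : ℝ × ℝ) :
    fderiv ℝ (fun x : ℝ × ℝ => -c * Real.sin (c * x.1) * Real.cos (d * x.2) * φ x) x (1, 0)
      = -c * Real.sin (c * x.1) * Real.cos (d * x.2) * fderiv ℝ φ x (1, 0)
        - c ^ 2 * (Real.cos (c * x.1) * Real.cos (d * x.2) * φ x) := by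
  have h := aux_deriv1 (fun x : ℝ × ℝ => -c * Real.sin (c * x.1) * Real.cos (d * x.2) * φ x)
    (by fun_prop) x.1 x.2
  have h2 := (((((hasDerivAt_id x.1).const_mul c).sin).const_mul (-c)).mul_const
    (Real.cos (d * x.2))).mul (aux_deriv1 φ hφ x.1 x.2)
  have := h.unique h2
  simp only [id] at this
  rw [this]; ring

lemma aux_w2 (c d : ℝ) (x : ℝ × ℝ) :
    fderiv ℝ (fun x : ℝ × ℝ => Real.cos (c * x.1) * Real.cos (d * x.2)) x (0, 1)
      = -d * Real.sin (d * x.2) * Real.cos (c * x.1) := by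
  have h := aux_swap (fun x : ℝ × ℝ => Real.cos (c * x.1) * Real.cos (d * x.2))
    (by fun_prop) x.swap
  rw [Prod.swap_swap] at h
  rw [← h, ← Prod.fst_swap (p := x), ← Prod.snd_swap (p := x), ← aux_w1 d c x.swap]
  congr 2
  funext y
  simp [mul_comm]

lemma aux_g2 (c d : ℝ) (φ : ℝ × ℝ → ℝ) (hφ : ContDiff ℝ 1 φ) (x : ℝ × ℝ) :
    fderiv ℝ (fun x : ℝ × ℝ => -d * Real.sin (d * x.2) * Real.cos (c * x.1) * φ x) x (0, 1)
      = -d * Real.sin (d * x.2) * Real.cos (c * x.1) * fderiv ℝ φ x (0, 1)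
        - d ^ 2 * (Real.cos (c * x.1) * Real.cos (d * x.2) * φ x) := by
  have h := aux_swap (fun x : ℝ × ℝ => -d * Real.sin (d * x.2) * Real.cos (c * x.1) * φ x)
    (by fun_prop) x.swap
  have h' := aux_swap φ hφ x.swap
  have h3 := aux_g1 d c (φ ∘ Prod.swap) (hφ.comp (contDiff_snd.prodMk contDiff_fst)) x.swap
  rw [Prod.swap_swap] at h h'
  rw [h'] at h3
  rw [← h]
  refine Eq.trans ?_ (h3.trans ?_)
  · rfl
  · simp only [Prod.fst_swap, Prod.snd_swap, Function.comp_apply, Prod.swap_swap]; ring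

open Classical in
/-- With `k² = (p²+q²)π²`, `w(x₁,x₂) = cos(pπx₁) cos(qπx₂)`,
`A = aI`, `n = a` on the unit square `Q` and `A = I`, `n = 1` outside, the function
`w` is a global weak solution of `∇⋅(A∇w) + k²nw = 0` in `ℝ²`: for every smooth,
compactly supported test function `φ`,
`∫ (A∇w)·∇φ = k² ∫ n w φ`. -/
theorem nonscattering_cos_weak_solution (a : ℝ) (ha : 0 < a) (p q : ℕ)
    (w : ℝ × ℝ → ℝ)
    (hw : w = fun x => Real.cos (p * π * x.1) * Real.cos (q * π * x.2))
    (Q : Set (ℝ × ℝ)) (hQ : Q = Set.Ioo (0 : ℝ) 1 ×ˢ Set.Ioo (0 : ℝ) 1)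
    (A : ℝ × ℝ → Matrix (Fin 2) (Fin 2) ℝ)
    (hA : A = fun x => if x ∈ Q then a • (1 : Matrix (Fin 2) (Fin 2) ℝ) else 1)
    (n : ℝ × ℝ → ℝ) (hn : n = fun x => if x ∈ Q then a else 1)
    (φ : ℝ × ℝ → ℝ) (hφ : ContDiff ℝ (⊤ : ℕ∞) φ) (hφc : HasCompactSupport φ) :
    ∫ x : ℝ × ℝ,
        (A x).mulVec ![fderiv ℝ w x (1, 0), fderiv ℝ w x (0, 1)] ⬝ᵥ
          ![fderiv ℝ φ x (1, 0), fderiv ℝ φ x (0, 1)]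
      = ((p ^ 2 + q ^ 2) * π ^ 2) * ∫ x : ℝ × ℝ, n x * w x * φ x := by
  have hφ1 : ContDiff ℝ 1 φ := hφ.of_le (by exact_mod_cast le_top)
  obtain ⟨c, hc⟩ : ∃ c : ℝ, c = p * π := ⟨_, rfl⟩
  obtain ⟨d, hd⟩ : ∃ d : ℝ, d = q * π := ⟨_, rfl⟩
  have hsc : Real.sin c = 0 := by rw [hc]; exact Real.sin_nat_mul_pi p
  have hsd : Real.sin d = 0 := by rw [hd]; exact Real.sin_nat_mul_pi q
  have hk : ((p : ℝ) ^ 2 + q ^ 2) * π ^ 2 = c ^ 2 + d ^ 2 := by rw [hc, hd]; ring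
  rw [hk]
  rw [← hc, ← hd] at hw
  set g1 : ℝ × ℝ → ℝ := fun x => -c * Real.sin (c * x.1) * Real.cos (d * x.2) * φ x with hg1
  set g2 : ℝ × ℝ → ℝ := fun x => -d * Real.sin (d * x.2) * Real.cos (c * x.1) * φ x with hg2
  have cg1 : ContDiff ℝ 1 g1 := by fun_prop
  have cg2 : ContDiff ℝ 1 g2 := by fun_prop
  have sg1 : HasCompactSupport g1 := hφc.mul_left
  have sg2 : HasCompactSupport g2 := hφc.mul_left
  have i1 := aux_int g1 cg1 sg1 (1, 0)
  have i2 := aux_int g2 cg2 sg2 (0, 1)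
  have f1 := aux_full g1 cg1 sg1
  have f2 := aux_full2 g2 cg2 sg2
  have q1 := aux_square g1 cg1 sg1 (by simp [hg1]) (by simp [hg1, hsc])
  have q2 := aux_square2 g2 cg2 sg2 (by simp [hg2]) (by simp [hg2, hsd])
  rw [← hQ] at q1 q2
  have mQ : MeasurableSet Q := by rw [hQ]; exact measurableSet_Ioo.prod measurableSet_Ioo
  let D : ℝ × ℝ → ℝ := fun x => fderiv ℝ g1 x (1, 0) + fderiv ℝ g2 x (0, 1)
  have iD : Integrable D := i1.add i2
  have fD : ∫ x, D x = 0 := by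
    simp only [D]; rw [integral_add i1 i2, f1, f2, add_zero]
  have qD : ∫ x in Q, D x = 0 := by
    simp only [D]; rw [integral_add i1.integrableOn i2.integrableOn, q1, q2, add_zero]
  have cw : Continuous w := by rw [hw]; fun_prop
  have iwφ : Integrable (fun x => w x * φ x) :=
    (cw.mul hφ1.continuous).integrable_of_hasCompactSupport hφc.mul_left
  have iR : Integrable (fun x => n x * w x * φ x) := by
    have h := iwφ.add ((iwφ.indicator mQ).const_mul (a - 1))
    refine h.congr (Filter.Eventually.of_forall fun x => ?_)
    by_cases hx : x ∈ Q <;> simp [hn, hx] <;> ring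
  have key : ∀ x, (A x).mulVec ![fderiv ℝ w x (1, 0), fderiv ℝ w x (0, 1)] ⬝ᵥ
          ![fderiv ℝ φ x (1, 0), fderiv ℝ φ x (0, 1)]
      = (D x + (a - 1) * Q.indicator D x) + (c ^ 2 + d ^ 2) * (n x * w x * φ x) := by
    intro x
    have e1 := aux_g1 c d φ hφ1 x
    have e2 := aux_g2 c d φ hφ1 x
    have e3 := aux_w1 c d x
    have e4 := aux_w2 c d x
    rw [← hw] at e3 e4
    have eD : D x = fderiv ℝ g1 x (1, 0) + fderiv ℝ g2 x (0, 1) := rfl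
    have ewx : w x = Real.cos (c * x.1) * Real.cos (d * x.2) := by rw [hw]
    rw [hg1, hg2, e1, e2] at eD
    rw [e3, e4, ewx]
    by_cases hx : x ∈ Q
    · simp only [hA, hn, hx, if_true, Set.indicator_of_mem, eD, Matrix.smul_mulVec,
        Matrix.one_mulVec, smul_dotProduct]
      simp [dotProduct, Fin.sum_univ_two]
      ring
    · simp only [hA, hn, hx, if_false, not_false_eq_true, Set.indicator_of_notMem, eD,
        Matrix.one_mulVec]
      simp [dotProduct, Fin.sum_univ_two]
      ring
  simp_rw [key]
  have iI := (iD.indicator mQ).const_mul (a - 1)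
  have iS : Integrable (fun x => D x + (a - 1) * Q.indicator D x) := iD.add iI
  rw [integral_add iS (iR.const_mul _), integral_const_mul]
  have : ∫ x, (D x + (a - 1) * Q.indicator D x) = 0 := by
    rw [integral_add iD iI, integral_const_mul, integral_indicator mQ, fD, qD]; simp
  rw [this, zero_add]
end

section
/- Let $a > 0$, let $p, q$ be positive integers, set $k^2 := (p^2+q^2)\pi^2$ and $w(x_1,x_2) := \sin(p\pi x_1)\sin(q\pi x_2)$. Define the coefficients $A(x) := a I$ and $n(x) := a$ for $x$ in the unit square $Q = (0,1)\times(0,1)$, and $A(x) := I$, $n(x) := 1$ for $x \notin Q$; define the total field $U(x) := w(x)$ for $x \in Q$ and $U(x) := a\, w(x)$ for $x \notin Q$, together with the (a.e. defined) gradient $G(x) := \nabla w(x)$ for $x \in Q$ and $G(x) := a \nabla w(x)$ for $x \notin Q$. Then $U$ is continuous on $\mathbb{R}^2$ and, for every smooth compactly supported test function $\varphi : \mathbb{R}^2 \to \mathbb{R}$, $\int_{\mathbb{R}^2} \big(A(x) G(x)\big) \cdot \nabla \varphi(x)\, dx = k^2 \int_{\mathbb{R}^2} n(x)\, U(x)\,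 \varphi(x)\, dx$. -/
open Real Matrix MeasureTheory

lemma nonscat_sin_fst (m : ℕ) (x : ℝ × ℝ) :
    HasFDerivAt (fun x : ℝ × ℝ => Real.sin (m * π * x.1))
      ((Real.cos (m * π * x.1) * (m * π)) • ContinuousLinearMap.fst ℝ ℝ ℝ) x := by
  have h : HasDerivAt (fun t : ℝ => Real.sin (m * π * t)) (Real.cos (m * π * x.1) * (m * π)) x.1 := by
    simpa using ((hasDerivAt_id x.1).const_mul (m * π : ℝ)).sin
  exact h.comp_hasFDerivAt x (ContinuousLinearMap.fst ℝ ℝ ℝ).hasFDerivAt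

lemma nonscat_sin_snd (m : ℕ) (x : ℝ × ℝ) :
    HasFDerivAt (fun x : ℝ × ℝ => Real.sin (m * π * x.2))
      ((Real.cos (m * π * x.2) * (m * π)) • ContinuousLinearMap.snd ℝ ℝ ℝ) x := by
  have h : HasDerivAt (fun t : ℝ => Real.sin (m * π * t)) (Real.cos (m * π * x.2) * (m * π)) x.2 := by
    simpa using ((hasDerivAt_id x.2).const_mul (m * π : ℝ)).sin
  exact h.comp_hasFDerivAt x (ContinuousLinearMap.snd ℝ ℝ ℝ).hasFDerivAt

lemma nonscat_cos_fst (m : ℕ) (x : ℝ × ℝ) :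
    HasFDerivAt (fun x : ℝ × ℝ => Real.cos (m * π * x.1))
      ((-Real.sin (m * π * x.1) * (m * π)) • ContinuousLinearMap.fst ℝ ℝ ℝ) x := by
  have h : HasDerivAt (fun t : ℝ => Real.cos (m * π * t)) (-Real.sin (m * π * x.1) * (m * π)) x.1 := by
    simpa using ((hasDerivAt_id x.1).const_mul (m * π : ℝ)).cos
  exact h.comp_hasFDerivAt x (ContinuousLinearMap.fst ℝ ℝ ℝ).hasFDerivAt

lemma nonscat_cos_snd (m : ℕ) (x : ℝ × ℝ) :
    HasFDerivAt (fun x : ℝ × ℝ => Real.cos (m * π * x.2))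
      ((-Real.sin (m * π * x.2) * (m * π)) • ContinuousLinearMap.snd ℝ ℝ ℝ) x := by
  have h : HasDerivAt (fun t : ℝ => Real.cos (m * π * t)) (-Real.sin (m * π * x.2) * (m * π)) x.2 := by
    simpa using ((hasDerivAt_id x.2).const_mul (m * π : ℝ)).cos
  exact h.comp_hasFDerivAt x (ContinuousLinearMap.snd ℝ ℝ ℝ).hasFDerivAt

open Classical in
/-- With `k² = (p²+q²)π²`, `w(x₁,x₂) = sin(pπx₁) sin(qπx₂)`,
`A = aI`, `n = a` on the unit square `Q` and `A = I`, `n = 1` outside, the total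
field `U = w` on `Q`, `U = a w` outside, with gradient `G = ∇w` on `Q`, `G = a∇w`
outside, is continuous on `ℝ²` and is a global weak solution of
`∇⋅(A∇U) + k²nU = 0`: for every smooth compactly supported test function `φ`,
`∫ (A G)·∇φ = k² ∫ n U φ`. -/
theorem nonscattering_sin_weak_solution (a : ℝ) (ha : 0 < a) (p q : ℕ)
    (hp : 0 < p) (hq : 0 < q)
    (w : ℝ × ℝ → ℝ)
    (hw : w = fun x => Real.sin (p * π * x.1) * Real.sin (q * π * x.2))
    (Q : Set (ℝ × ℝ)) (hQ : Q = Set.Ioo (0 : ℝ) 1 ×ˢ Set.Ioo (0 : ℝ) 1)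
    (A : ℝ × ℝ → Matrix (Fin 2) (Fin 2) ℝ)
    (hA : A = fun x => if x ∈ Q then a • (1 : Matrix (Fin 2) (Fin 2) ℝ) else 1)
    (n : ℝ × ℝ → ℝ) (hn : n = fun x => if x ∈ Q then a else 1)
    (U : ℝ × ℝ → ℝ) (hU : U = fun x => if x ∈ Q then w x else a * w x)
    (G : ℝ × ℝ → Fin 2 → ℝ)
    (hG : G = fun x => if x ∈ Q then ![fderiv ℝ w x (1, 0), fderiv ℝ w x (0, 1)]
      else a • ![fderiv ℝ w x (1, 0), fderiv ℝ w x (0, 1)]) :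
    Continuous U ∧
    ∀ φ : ℝ × ℝ → ℝ, ContDiff ℝ (⊤ : ℕ∞) φ → HasCompactSupport φ →
      ∫ x : ℝ × ℝ, (A x).mulVec (G x) ⬝ᵥ ![fderiv ℝ φ x (1, 0), fderiv ℝ φ x (0, 1)]
        = ((p ^ 2 + q ^ 2) * π ^ 2) * ∫ x : ℝ × ℝ, n x * U x * φ x := by
  classical
  have hwd : ∀ x : ℝ × ℝ, HasFDerivAt w
      ((Real.sin (p * π * x.1)) • ((Real.cos (q * π * x.2) * (q * π)) • ContinuousLinearMap.snd ℝ ℝ ℝ)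
        + (Real.sin (q * π * x.2)) • ((Real.cos (p * π * x.1) * (p * π)) • ContinuousLinearMap.fst ℝ ℝ ℝ)) x := by
    intro x
    rw [hw]
    exact (nonscat_sin_fst p x).mul (nonscat_sin_snd q x)
  have hw1 : ∀ x, fderiv ℝ w x (1, 0) = p * π * (Real.cos (p * π * x.1) * Real.sin (q * π * x.2)) := by
    intro x
    rw [(hwd x).fderiv]
    simp
    ring
  have hw2 : ∀ x, fderiv ℝ w x (0, 1) = q * π * (Real.sin (p * π * x.1) * Real.cos (q * π * x.2)) := by
    intro x
    rw [(hwd x).fderiv]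
    simp
    ring
  have hwc : Continuous w := by rw [hw]; fun_prop
  constructor
  · rw [hU]
    refine Continuous.if ?_ hwc (continuous_const.mul hwc)
    intro x hx
    have h0 : w x = 0 := by
      have hx' : x ∈ frontier Q := hx
      rw [hQ, frontier_prod_eq, frontier_Ioo zero_lt_one] at hx'
      rw [hw]
      have hs : ∀ (m : ℕ) (t : ℝ), t ∈ ({0, 1} : Set ℝ) → Real.sin (m * π * t) = 0 := by
        rintro m t (rfl | rfl)
        · simp
        · simp
      rcases hx' with ⟨_, h⟩ | ⟨h, _⟩
      · simp [hs q _ h]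
      · simp [hs p _ h]
    simp [h0]
  · intro φ hφ hc
    have hφd : Differentiable ℝ φ := hφ.differentiable (by simp)
    have hφ1 : ∀ v, Continuous fun x => fderiv ℝ φ x v := fun v =>
      (hφ.continuous_fderiv (by simp)).clm_apply continuous_const
    have hcs : ∀ v, HasCompactSupport fun x => fderiv ℝ φ x v := fun v => hc.fderiv_apply (𝕜 := ℝ) v
    have ibp : ∀ (g : ℝ × ℝ → ℝ) (v : ℝ × ℝ), ContDiff ℝ 1 g →
        Integrable (fun x => g x * fderiv ℝ φ x v) ∧
        ∫ x, g x * fderiv ℝ φ x v = - ∫ x, fderiv ℝ g x v * φ x := by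
      intro g v hg
      have hgc := hg.continuous
      have hg1 : Continuous fun x => fderiv ℝ g x v :=
        (hg.continuous_fderiv (by simp)).clm_apply continuous_const
      have i1 : Integrable (fun x => g x * fderiv ℝ φ x v) :=
        (hgc.mul (hφ1 v)).integrable_of_hasCompactSupport ((hcs v).mul_left)
      refine ⟨i1, ?_⟩
      exact integral_mul_fderiv_eq_neg_fderiv_mul_of_integrable
        ((hg1.mul hφd.continuous).integrable_of_hasCompactSupport hc.mul_left) i1
        ((hgc.mul hφd.continuous).integrable_of_hasCompactSupport hc.mul_left)
        (fun x _ => hg.differentiable (by simp) x) (fun x _ => hφd x)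
    obtain ⟨j1, e1⟩ := ibp (fun x => a * (p * π * (Real.cos (p * π * x.1) * Real.sin (q * π * x.2)))) (1, 0)
      (by fun_prop)
    obtain ⟨j2, e2⟩ := ibp (fun x => a * (q * π * (Real.sin (p * π * x.1) * Real.cos (q * π * x.2)))) (0, 1)
      (by fun_prop)
    have d1 : ∀ x : ℝ × ℝ, fderiv ℝ (fun x : ℝ × ℝ => a * (p * π * (Real.cos (p * π * x.1) * Real.sin (q * π * x.2)))) x (1, 0)
        = - (a * (p * π) ^ 2 * w x) := by
      intro x
      have hd := ((((nonscat_cos_fst p x).mul (nonscat_sin_snd q x)).const_mul (p * π : ℝ)).const_mul a).fderiv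
      refine (DFunLike.congr_fun hd ((1 : ℝ), (0 : ℝ))).trans ?_
      rw [hw]
      simp
      ring
    have d2 : ∀ x : ℝ × ℝ, fderiv ℝ (fun x : ℝ × ℝ => a * (q * π * (Real.sin (p * π * x.1) * Real.cos (q * π * x.2)))) x (0, 1)
        = - (a * (q * π) ^ 2 * w x) := by
      intro x
      have hd := ((((nonscat_sin_fst p x).mul (nonscat_cos_snd q x)).const_mul (q * π : ℝ)).const_mul a).fderiv
      refine (DFunLike.congr_fun hd ((0 : ℝ), (1 : ℝ))).trans ?_
      rw [hw]
      simp
      ring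
    have hL : ∀ x, (A x).mulVec (G x) ⬝ᵥ ![fderiv ℝ φ x (1, 0), fderiv ℝ φ x (0, 1)]
        = a * (p * π * (Real.cos (p * π * x.1) * Real.sin (q * π * x.2))) * fderiv ℝ φ x (1, 0)
          + a * (q * π * (Real.sin (p * π * x.1) * Real.cos (q * π * x.2))) * fderiv ℝ φ x (0, 1) := by
      intro x
      rw [hA, hG]
      by_cases h : x ∈ Q <;>
        simp [h, hw1, hw2, Matrix.smul_mulVec, dotProduct, Fin.sum_univ_two]
    have hR : ∀ x, n x * U x * φ x = a * (w x * φ x) := by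
      intro x
      rw [hn, hU]
      by_cases h : x ∈ Q <;> simp [h] <;> ring
    simp_rw [hL, hR]
    rw [integral_add j1 j2, e1, e2]
    simp_rw [d1, d2, neg_mul, mul_assoc, integral_neg, integral_const_mul]
    ring
end
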